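/- Let n ≥ 2, k ≥ 4, 0 < ε ≤ 1, let f : S_k^n → [k] be an SCF, and let a, b, c, d be alternatives with a ≠ b, c ≠ d, and {a,b} ∩ {c,d} = ∅. Then it cannot hold simultaneously that P(σ ∈ Lg(B_1^{a,b})) ≥ ε/(n k^3) and P(σ ∈ Lg(B_2^{c,d})) ≥ ε/(n k^3). -/

import Mathlib

open Finset

/-- `a` is ranked above `b` in the ranking `τ` (a ranking maps positions to
alternatives; earlier positions are better). -/
def Above {k : ℕ} (τ : Equiv.Perm (Fin k)) (a b : Fin k) : Prop :=
  τ.symm a < τ.symm b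

/-- Uniform probability of an event over a finite type. -/
noncomputable def prob {Ω : Type*} [Fintype Ω] (p : Ω → Prop) : ℝ := by
  classical exact ((Finset.univ.filter p).card : ℝ) / (Fintype.card Ω : ℝ)

/-- Number of elements satisfying an event, as a real number. -/
noncomputable def count {Ω : Type*} [Fintype Ω] (p : Ω → Prop) : ℝ := by
  classical exact ((Finset.univ.filter p).card : ℝ)

/-- A ranking profile for `n` voters and `k` alternatives. -/
abbrev Profile (n k : ℕ) := Fin n → Equiv.Perm (Fin k)

/-- `(σ, σ')` is a manipulation pair for `f` at coordinate `i`: they differ exactly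
in coordinate `i` and voter `i` truly prefers `f σ'` to `f σ`. -/
def IsManipPairAt {n k : ℕ} (f : Profile n k → Fin k) (σ σ' : Profile n k) (i : Fin n) : Prop :=
  σ i ≠ σ' i ∧ (∀ j, j ≠ i → σ j = σ' j) ∧ Above (σ i) (f σ') (f σ)

/-- `σ` is a manipulation point of `f`, i.e. `σ ∈ M(f)`. -/
def IsManipPoint {n k : ℕ} (f : Profile n k → Fin k) (σ : Profile n k) : Prop :=
  ∃ σ' i, IsManipPairAt f σ σ' i

/-- `τ` and `τ'` agree outside a block of at most `r` consecutive positions. -/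
def AgreeOutsideBlock {k : ℕ} (r : ℕ) (τ τ' : Equiv.Perm (Fin k)) : Prop :=
  ∃ l : ℕ, ∀ p : Fin k, ((p : ℕ) < l ∨ l + r ≤ (p : ℕ)) → τ p = τ' p

/-- `σ` is an `r`-manipulation point of `f`, i.e. `σ ∈ M_r(f)`. -/
def IsManipPointR {n k : ℕ} (r : ℕ) (f : Profile n k → Fin k) (σ : Profile n k) : Prop :=
  ∃ σ' i, IsManipPairAt f σ σ' i ∧ AgreeOutsideBlock r (σ i) (σ' i)

/-- `f` always elects the top alternative of `H` according to voter `i`. -/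
def IsTopOn {n k : ℕ} (f : Profile n k → Fin k) (i : Fin n) (H : Finset (Fin k)) : Prop :=
  ∀ σ, f σ ∈ H ∧ ∀ b ∈ H, b ≠ f σ → Above (σ i) (f σ) b

/-- `f` takes exactly two values. -/
def TakesExactlyTwoValues {n k : ℕ} (f : Profile n k → Fin k) : Prop :=
  ∃ a b : Fin k, a ≠ b ∧ (∀ σ, f σ = a ∨ f σ = b) ∧ (∃ σ, f σ = a) ∧ (∃ σ, f σ = b)

/-- `f` is monotone: whenever `σ, σ'` differ in exactly one coordinate `i` and
`f σ ≠ f σ'`, voter `i` ranks `f σ'` above `f σ` in `σ' i`. -/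
def IsMonotone {n k : ℕ} (f : Profile n k → Fin k) : Prop :=
  ∀ (σ σ' : Profile n k) (i : Fin n),
    σ i ≠ σ' i → (∀ j, j ≠ i → σ j = σ' j) → f σ ≠ f σ' → Above (σ' i) (f σ') (f σ)

/-- The family `NONMANIP(n,k)` of nonmanipulable social choice functions. -/
def InNonManip {n k : ℕ} (f : Profile n k → Fin k) : Prop :=
  (∃ (i : Fin n) (H : Finset (Fin k)), H.Nonempty ∧ IsTopOn f i H) ∨
  (TakesExactlyTwoValues f ∧ IsMonotone f)

/-- The family `NONMANIP-bar`: functions depending on one coordinate only,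
or taking at most two values. -/
def InNonManipBar {n k : ℕ} (f : Profile n k → Fin k) : Prop :=
  (∃ i : Fin n, ∀ σ σ' : Profile n k, σ i = σ' i → f σ = f σ') ∨
  (∃ a b : Fin k, ∀ σ, f σ = a ∨ f σ = b)

/-- `σ` lies in the fiber `F(z^{a,b})`: `z i = true` iff voter `i` prefers `a` to `b`. -/
def InFiber {n k : ℕ} (a b : Fin k) (z : Fin n → Bool) (σ : Profile n k) : Prop :=
  ∀ i, Above (σ i) a b ↔ z i = true

/-- `σ` is on the boundary `B_i^{a,b}(f)`: `f σ = a` and some `σ'` differing from `σ`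
only in coordinate `i` has `f σ' = b`. -/
def OnBoundaryB {n k : ℕ} (f : Profile n k → Fin k) (i : Fin n) (a b : Fin k)
    (σ : Profile n k) : Prop :=
  f σ = a ∧ ∃ σ' : Profile n k, σ i ≠ σ' i ∧ (∀ j, j ≠ i → σ j = σ' j) ∧ f σ' = b

/-- `σ ∈ B_i(z^{a,b})`. -/
def InBFiber {n k : ℕ} (f : Profile n k → Fin k) (i : Fin n) (a b : Fin k)
    (z : Fin n → Bool) (σ : Profile n k) : Prop :=
  InFiber a b z σ ∧ OnBoundaryB f i a b σ

/-- The fiber `B_i(z^{a,b})` is large (for the parameter `ε`):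
`P(σ ∈ B_i(z^{a,b}) | σ ∈ F(z^{a,b})) ≥ 1 - ε^3/(4 n^3 k^9)`. -/
def IsLargeFiber {n k : ℕ} (f : Profile n k → Fin k) (ε : ℝ) (i : Fin n) (a b : Fin k)
    (z : Fin n → Bool) : Prop :=
  1 - ε ^ 3 / (4 * (n : ℝ) ^ 3 * (k : ℝ) ^ 9) ≤
    prob (fun σ : Profile n k => InBFiber f i a b z σ) /
      prob (fun σ : Profile n k => InFiber a b z σ)

/-- `σ ∈ Lg(B_i^{a,b})`, the union of the large fibers. -/
def InLg {n k : ℕ} (f : Profile n k → Fin k) (ε : ℝ) (i : Fin n) (a b : Fin k)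
    (σ : Profile n k) : Prop :=
  ∃ z, IsLargeFiber f ε i a b z ∧ InBFiber f i a b z σ

/-- `σ ∈ Sm(B_i^{a,b})`, the union of the small fibers. -/
def InSm {n k : ℕ} (f : Profile n k → Fin k) (ε : ℝ) (i : Fin n) (a b : Fin k)
    (σ : Profile n k) : Prop :=
  ∃ z, ¬ IsLargeFiber f ε i a b z ∧ InBFiber f i a b z σ

/-- Two profiles differ in exactly one coordinate. -/
def AdjOneCoord {n k : ℕ} (σ π : Profile n k) : Prop :=
  ∃ i, σ i ≠ π i ∧ ∀ j, j ≠ i → σ j = π j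

/-- `σ` belongs to the vertex boundary `∂(B_i(z^{a,b}))` of `B_i(z^{a,b})` inside the
fiber `F(z^{a,b})`. -/
def InFiberBdry {n k : ℕ} (f : Profile n k → Fin k) (i : Fin n) (a b : Fin k)
    (z : Fin n → Bool) (σ : Profile n k) : Prop :=
  InBFiber f i a b z σ ∧
    ∃ π, AdjOneCoord σ π ∧ InFiber a b z π ∧ ¬ InBFiber f i a b z π

/-- `σ₋ᵢ ∈ D_i(a,b)`: fixing all coordinates except `i` according to `σ`, the induced
one-voter SCF equals `top_H` for some `H ⊇ {a,b}` with `|H| ≥ 3`. -/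
def InD1 {n k : ℕ} (f : Profile n k → Fin k) (i : Fin n) (a b : Fin k)
    (σ : Profile n k) : Prop :=
  ∃ H : Finset (Fin k), a ∈ H ∧ b ∈ H ∧ 3 ≤ H.card ∧
    ∀ τ : Equiv.Perm (Fin k),
      f (Function.update σ i τ) ∈ H ∧
        ∀ c ∈ H, c ≠ f (Function.update σ i τ) → Above τ (f (Function.update σ i τ)) c


noncomputable def prefVec {n k : ℕ} (a b : Fin k) (σ : Profile n k) : Fin n → Bool := by
  classical exact fun i => decide (Above (σ i) a b)

lemma inFiber_iff {n k : ℕ} (a b : Fin k) (z : Fin n → Bool) (σ : Profile n k) :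
    InFiber a b z σ ↔ prefVec a b σ = z := by
  unfold InFiber prefVec
  rw [funext_iff]
  refine forall_congr' fun i => ?_
  cases hz : z i <;> simp

lemma card_const_fiber {Ω Z : Type*} [Fintype Ω] [DecidableEq Z] (P : Ω → Z) (m : ℕ)
    (h : ∀ p, (univ.filter (fun ω => P ω = p)).card = m) (S : Finset Z) :
    (univ.filter (fun ω => P ω ∈ S)).card = S.card * m := by
  rw [Finset.card_eq_sum_card_fiberwise (f := P) (t := S) (fun x hx => by simpa using hx)]
  rw [Finset.sum_congr rfl (g := fun _ => m)]
  · simp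
  · intro p hp
    rw [← h p]
    congr 1
    ext ω
    simp only [mem_filter, mem_univ, true_and]
    constructor
    · exact fun h => h.2
    · exact fun h => ⟨h ▸ hp, h⟩

/-- flip the order of `a`, `b` for the voters in `s`. -/
def flipAB {n k : ℕ} (a b : Fin k) (s : Fin n → Bool) (σ : Profile n k) : Profile n k :=
  fun i => if s i then Equiv.swap a b * σ i else σ i

lemma flipAB_invol {n k : ℕ} (a b : Fin k) (s : Fin n → Bool) (σ : Profile n k) :
    flipAB a b s (flipAB a b s σ) = σ := by
  funext i
  unfold flipAB
  by_cases h : s i = true <;> simp [h]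

lemma above_swap_same {k : ℕ} (a b : Fin k) (hab : a ≠ b) (τ : Equiv.Perm (Fin k)) :
    Above (Equiv.swap a b * τ) a b ↔ ¬ Above τ a b := by
  have hne : τ.symm a ≠ τ.symm b := fun h => hab (τ.symm.injective h)
  have e : ∀ x, (Equiv.swap a b * τ).symm x = τ.symm (Equiv.swap a b x) := fun x => rfl
  simp only [Above, e, Equiv.swap_apply_left, Equiv.swap_apply_right, not_lt]
  exact ⟨le_of_lt, fun h => lt_of_le_of_ne h hne.symm⟩

lemma above_swap_other {k : ℕ} (a b c d : Fin k) (hac : a ≠ c) (had : a ≠ d) (hbc : b ≠ c)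
    (hbd : b ≠ d) (τ : Equiv.Perm (Fin k)) :
    Above (Equiv.swap a b * τ) c d ↔ Above τ c d := by
  have e : ∀ x, (Equiv.swap a b * τ).symm x = τ.symm (Equiv.swap a b x) := fun x => rfl
  simp only [Above, e, Equiv.swap_apply_of_ne_of_ne hac.symm hbc.symm,
    Equiv.swap_apply_of_ne_of_ne had.symm hbd.symm]

lemma prefVec_flip_same {n k : ℕ} (a b : Fin k) (hab : a ≠ b) (s : Fin n → Bool)
    (σ : Profile n k) :
    prefVec a b (flipAB a b s σ) = fun i => xor (s i) (prefVec a b σ i) := by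
  funext i
  unfold prefVec flipAB
  by_cases h : s i = true
  · rw [Bool.eq_iff_iff]
    simp [h, above_swap_same a b hab]
  · simp [h]

lemma prefVec_flip_other {n k : ℕ} (a b c d : Fin k) (hac : a ≠ c) (had : a ≠ d) (hbc : b ≠ c)
    (hbd : b ≠ d) (s : Fin n → Bool) (σ : Profile n k) :
    prefVec c d (flipAB a b s σ) = prefVec c d σ := by
  funext i
  unfold prefVec flipAB
  by_cases h : s i = true
  · simp [h, above_swap_other a b c d hac had hbc hbd]
  · simp [h]

lemma card_le_flip {n k : ℕ} (a b c d : Fin k) (hab : a ≠ b)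
    (hac : a ≠ c) (had : a ≠ d) (hbc : b ≠ c) (hbd : b ≠ d) (z z' w : Fin n → Bool) :
    (univ.filter (fun σ : Profile n k => prefVec a b σ = z ∧ prefVec c d σ = w)).card ≤
    (univ.filter (fun σ : Profile n k => prefVec a b σ = z' ∧ prefVec c d σ = w)).card := by
  apply Finset.card_le_card_of_injOn (flipAB a b (fun i => xor (z i) (z' i)))
  · intro σ hσ
    simp only [coe_filter, mem_univ, true_and, Set.mem_ofPred_eq] at hσ ⊢
    rw [prefVec_flip_same a b hab, prefVec_flip_other a b c d hac had hbc hbd, hσ.1]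
    refine ⟨?_, hσ.2⟩
    funext i
    cases z i <;> cases z' i <;> rfl
  · intro σ _ τ _ h
    rw [← flipAB_invol a b (fun i => xor (z i) (z' i)) σ, h, flipAB_invol]

lemma card_le_all {n k : ℕ} (a b c d : Fin k) (hab : a ≠ b) (hcd : c ≠ d)
    (hac : a ≠ c) (had : a ≠ d) (hbc : b ≠ c) (hbd : b ≠ d) (p q : (Fin n → Bool) × (Fin n → Bool)) :
    (univ.filter (fun σ : Profile n k => (prefVec a b σ, prefVec c d σ) = p)).card ≤
    (univ.filter (fun σ : Profile n k => (prefVec a b σ, prefVec c d σ) = q)).card := by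
  obtain ⟨z, w⟩ := p
  obtain ⟨z', w'⟩ := q
  simp only [Prod.mk.injEq]
  refine (card_le_flip a b c d hab hac had hbc hbd z z' w).trans ?_
  have := card_le_flip c d a b hcd hac.symm hbc.symm had.symm hbd.symm w w' z'
  simpa only [and_comm] using this

lemma indep {n k : ℕ} (a b c d : Fin k) (hab : a ≠ b) (hcd : c ≠ d)
    (hac : a ≠ c) (had : a ≠ d) (hbc : b ≠ c) (hbd : b ≠ d) (A C : Finset (Fin n → Bool)) :
    (univ.filter (fun σ : Profile n k => prefVec a b σ ∈ A ∧ prefVec c d σ ∈ C)).card *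
      Fintype.card (Profile n k) =
    (univ.filter (fun σ : Profile n k => prefVec a b σ ∈ A)).card *
    (univ.filter (fun σ : Profile n k => prefVec c d σ ∈ C)).card := by
  have key := card_const_fiber (fun σ : Profile n k => (prefVec a b σ, prefVec c d σ)) _
    (fun p => le_antisymm (card_le_all a b c d hab hcd hac had hbc hbd p (default, default))
      (card_le_all a b c d hab hcd hac had hbc hbd (default, default) p))
  have h1 := key (A ×ˢ C)
  have h2 := key (A ×ˢ univ)
  have h3 := key (univ ×ˢ C)
  have h4 := key univ
  simp only [mem_product, mem_univ, and_true, true_and, card_product, filter_true, card_univ,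
    Fintype.card_prod] at h1 h2 h3 h4
  rw [h1, h2, h3, h4]
  ring

/-- On the union of large fibers `f = a` fails rarely. -/
lemma large_bad {n k : ℕ} (f : Profile n k → Fin k) (ε : ℝ) (hε0 : 0 < ε) (i : Fin n) (a b : Fin k)
    (A : Finset (Fin n → Bool)) (hA : ∀ z ∈ A, IsLargeFiber f ε i a b z) :
    ((univ.filter (fun σ : Profile n k => prefVec a b σ ∈ A ∧ f σ ≠ a)).card : ℝ) ≤
      ε ^ 3 / (4 * (n : ℝ) ^ 3 * (k : ℝ) ^ 9) * (Fintype.card (Profile n k) : ℝ) := by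
  classical
  set η := ε ^ 3 / (4 * (n : ℝ) ^ 3 * (k : ℝ) ^ 9) with hη
  have hη0 : 0 ≤ η := by positivity
  have hN : (0 : ℝ) < Fintype.card (Profile n k) := by exact_mod_cast Fintype.card_pos
  have step : ∀ z ∈ A, ((univ.filter (fun σ : Profile n k => prefVec a b σ = z ∧ f σ ≠ a)).card : ℝ)
      ≤ η * (univ.filter (fun σ : Profile n k => prefVec a b σ = z)).card := by
    intro z hz
    have hl := hA z hz
    unfold IsLargeFiber prob at hl
    rw [← hη, div_div_div_cancel_right₀ hN.ne'] at hl
    simp only [inFiber_iff, InBFiber] at hl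
    have hsub : (univ.filter (fun σ : Profile n k => prefVec a b σ = z ∧ f σ ≠ a)).card +
        (univ.filter (fun σ : Profile n k => prefVec a b σ = z ∧ OnBoundaryB f i a b σ)).card ≤
        (univ.filter (fun σ : Profile n k => prefVec a b σ = z)).card := by
      rw [← Finset.card_union_of_disjoint]
      · apply Finset.card_le_card
        intro σ
        simp only [mem_union, mem_filter, mem_univ, true_and]
        tauto
      · rw [Finset.disjoint_left]
        intro σ
        simp only [mem_filter, mem_univ, true_and]
        exact fun h1 h2 => h1.2 h2.2.1
    have hsubR : ((univ.filter (fun σ : Profile n k => prefVec a b σ = z ∧ f σ ≠ a)).card : ℝ) +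
        (univ.filter (fun σ : Profile n k => prefVec a b σ = z ∧ OnBoundaryB f i a b σ)).card ≤
        (univ.filter (fun σ : Profile n k => prefVec a b σ = z)).card := by exact_mod_cast hsub
    rcases (Nat.cast_nonneg (α := ℝ)
      (univ.filter (fun σ : Profile n k => prefVec a b σ = z)).card).eq_or_lt with h0 | h0
    · have : (0 : ℝ) ≤ (univ.filter (fun σ : Profile n k =>
        prefVec a b σ = z ∧ OnBoundaryB f i a b σ)).card := Nat.cast_nonneg _
      rw [← h0] at hsubR ⊢
      linarith
    · rw [le_div_iff₀ h0] at hl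
      linarith
  have e1 : (univ.filter (fun σ : Profile n k => prefVec a b σ ∈ A ∧ f σ ≠ a)).card =
      ∑ z ∈ A, (univ.filter (fun σ : Profile n k => prefVec a b σ = z ∧ f σ ≠ a)).card := by
    rw [Finset.card_eq_sum_card_fiberwise (f := prefVec a b) (t := A)
      (fun x hx => by simp at hx; simpa using hx.1)]
    refine Finset.sum_congr rfl fun z hz => ?_
    congr 1
    ext σ
    simp only [mem_filter, mem_univ, true_and]
    constructor
    · exact fun h => ⟨h.2, h.1.2⟩
    · exact fun h => ⟨⟨h.1 ▸ hz, h.2⟩, h.1⟩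
  have e2 : Fintype.card (Profile n k) =
      ∑ z, (univ.filter (fun σ : Profile n k => prefVec a b σ = z)).card := by
    rw [← Finset.card_univ]
    exact Finset.card_eq_sum_card_fiberwise (fun x _ => by simp)
  rw [e1, e2]
  push_cast
  rw [Finset.mul_sum]
  exact (Finset.sum_le_sum step).trans
    (Finset.sum_le_sum_of_subset_of_nonneg (subset_univ A) (fun _ _ _ => by positivity))

theorem stmt6 (n k : ℕ) (hn : 2 ≤ n) (hk : 4 ≤ k)
    (ε : ℝ) (hε0 : 0 < ε) (hε1 : ε ≤ 1)
    (f : Profile n k → Fin k) (a b c d : Fin k)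
    (hab : a ≠ b) (hcd : c ≠ d)
    (hac : a ≠ c) (had : a ≠ d) (hbc : b ≠ c) (hbd : b ≠ d) :
    ¬ (ε / ((n : ℝ) * (k : ℝ) ^ 3) ≤
        prob (fun σ : Profile n k => InLg f ε ⟨0, by omega⟩ a b σ) ∧
       ε / ((n : ℝ) * (k : ℝ) ^ 3) ≤
        prob (fun σ : Profile n k => InLg f ε ⟨1, by omega⟩ c d σ)) := by
  classical
  rintro ⟨h1, h2⟩
  have hN : (0 : ℝ) < Fintype.card (Profile n k) := by exact_mod_cast Fintype.card_pos
  have hn0 : (1 : ℝ) ≤ n := by exact_mod_cast (by omega : 1 ≤ n)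
  have hk0 : (1 : ℝ) ≤ k := by exact_mod_cast (by omega : 1 ≤ k)
  set δ := ε / ((n : ℝ) * (k : ℝ) ^ 3) with hδ
  have hδ0 : 0 < δ := by positivity
  have hδ1 : δ ≤ 1 := by
    rw [hδ, div_le_one (by positivity)]
    exact hε1.trans (one_le_mul_of_one_le_of_one_le hn0 (one_le_pow₀ hk0))
  have hη : ε ^ 3 / (4 * (n : ℝ) ^ 3 * (k : ℝ) ^ 9) = δ ^ 3 / 4 := by
    rw [hδ]; field_simp
  have hp : ∀ (i : Fin n) (x y : Fin k), δ ≤ prob (fun σ : Profile n k => InLg f ε i x y σ) →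
      δ * Fintype.card (Profile n k) ≤ (univ.filter (fun σ : Profile n k =>
        prefVec x y σ ∈ univ.filter (fun z => IsLargeFiber f ε i x y z))).card := by
    intro i x y h
    unfold prob at h
    rw [le_div_iff₀ hN] at h
    refine h.trans ?_
    norm_cast
    apply Finset.card_le_card
    intro σ
    simp only [mem_filter, mem_univ, true_and]
    rintro ⟨z, hz, hz2⟩
    rw [(inFiber_iff x y z σ).1 hz2.1]
    exact hz
  have g1 := hp _ _ _ h1
  have g2 := hp _ _ _ h2
  set A := univ.filter (fun z => IsLargeFiber f ε (⟨0, by omega⟩ : Fin n) a b z) with hA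
  set C := univ.filter (fun z => IsLargeFiber f ε (⟨1, by omega⟩ : Fin n) c d z) with hC
  have b1 := large_bad f ε hε0 _ a b A (fun z hz => (mem_filter.1 hz).2)
  have b2 := large_bad f ε hε0 _ c d C (fun z hz => (mem_filter.1 hz).2)
  have hi := indep (n := n) a b c d hab hcd hac had hbc hbd A C
  have hu : (univ.filter (fun σ : Profile n k => prefVec a b σ ∈ A ∧ prefVec c d σ ∈ C)).card ≤
      (univ.filter (fun σ : Profile n k => prefVec a b σ ∈ A ∧ f σ ≠ a)).card +
      (univ.filter (fun σ : Profile n k => prefVec c d σ ∈ C ∧ f σ ≠ c)).card := by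
    refine le_trans (Finset.card_le_card ?_) (Finset.card_union_le _ _)
    intro σ
    simp only [mem_union, mem_filter (s := (univ : Finset (Profile n k))), mem_univ, true_and]
    rintro ⟨hx, hy⟩
    by_cases hf : f σ = a
    · exact Or.inr ⟨hy, hf ▸ hac⟩
    · exact Or.inl ⟨hx, hf⟩
  rw [hη] at b1 b2
  have hiR := congrArg (Nat.cast : ℕ → ℝ) hi
  have huR := (Nat.cast_le (α := ℝ)).2 hu
  push_cast at hiR huR
  set N : ℝ := (Fintype.card (Profile n k) : ℝ)
  have hm := mul_le_mul g1 g2 (by positivity) (by positivity)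
  rw [← hiR] at hm
  have h5 := mul_le_mul_of_nonneg_right (huR.trans (add_le_add b1 b2)) hN.le
  have h6 : δ ^ 2 * N ^ 2 ≤ δ ^ 3 / 2 * N ^ 2 := by nlinarith
  have h7 : δ ^ 2 ≤ δ ^ 3 / 2 := le_of_mul_le_mul_right h6 (by positivity)
  nlinarith [pow_pos hδ0 2]
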